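/- arXiv:2106.05381 — 2 statements merged into one kernel-verified Lean document; each statement's English description precedes it below -/
import Mathlib

section
/- The semisimple trace is well-defined and additive: if Y is a finite-dimensional continuous representation of H × W over ℚ̄_ℓ, where H is a finite group and W contains a normal subgroup I acting through admissible filtrations, then for any two admissible filtrations Y_• and Y'_• of Y (filtrations on whose associated graded pieces I acts through a finite quotient), the traces of h × w on the I-invariants of the associated graded representations agree: tr(h × w | (gr Y_•)^I) = tr(h × w | (gr Y'_•)^I). Moreover, the resulting function Y ↦ tr^ss(h × w | Y) is additive in short exact sequences of such representations. -/
noncomputable section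

variable {k : Type*} [Field k] {G : Type*} [Group G]
variable {V : Type*} [AddCommGroup V] [Module k V]

/-- A submodule is invariant under a representation. -/
def IsSubrep (ρ : Representation k G V) (p : Submodule k V) : Prop :=
  ∀ g : G, ∀ v ∈ p, ρ g v ∈ p

/-- The endomorphism induced by `ρ g` on the graded piece `q / p` of two invariant
submodules `p ⊆ q`. -/
def gradedMap (ρ : Representation k G V) (p q : Submodule k V)
    (hp : IsSubrep ρ p) (hq : IsSubrep ρ q) (g : G) :
    (q ⧸ p.comap q.subtype) →ₗ[k] (q ⧸ p.comap q.subtype) :=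
  Submodule.mapQ _ _ ((ρ g).restrict fun x hx => hq g x hx)
    (fun x hx => by
      have : ((((ρ g).restrict fun y hy => hq g y hy) x : V)) = ρ g (x : V) := rfl
      simpa [Submodule.mem_comap, this] using hp g _ hx)

/-- Trace of an endomorphism on an invariant submodule (junk value `0` otherwise). -/
def traceOn {M : Type*} [AddCommGroup M] [Module k M]
    (p : Submodule k M) (f : M →ₗ[k] M) : k :=
  letI := Classical.dec (∀ v ∈ p, f v ∈ p)
  if h : ∀ v ∈ p, f v ∈ p then LinearMap.trace k p (f.restrict h) else 0

/-- An admissible filtration of a representation `ρ` with respect to a subgroup `I`: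
an exhaustive filtration `0 = Y_0 ⊆ Y_1 ⊆ ⋯ ⊆ Y_d = Y` by subrepresentations such that `I`
acts through a finite quotient on each graded piece (the image of `I` in the endomorphisms of
each graded piece is finite). -/
structure AdmissibleFiltration (ρ : Representation k G V) (I : Subgroup G) where
  len : ℕ
  filt : Fin (len + 1) → Submodule k V
  mono : Monotone filt
  bot_eq : filt 0 = ⊥
  top_eq : filt (Fin.last len) = ⊤
  inv : ∀ i, IsSubrep ρ (filt i)
  adm : ∀ i : Fin len, Set.Finite (Set.range fun τ : I =>
    gradedMap ρ (filt i.castSucc) (filt i.succ) (inv _) (inv _) (τ : G))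

/-- The semisimple trace of `g` on `ρ` with respect to an admissible filtration `Y`:
the sum over the graded pieces of the trace of the induced endomorphism on the `I`-invariants
of the graded piece. -/
def ssTrace (ρ : Representation k G V) (I : Subgroup G)
    (Y : AdmissibleFiltration ρ I) (g : G) : k :=
  ∑ i : Fin Y.len,
    traceOn
      (⨅ τ : I, LinearMap.ker
        (gradedMap ρ (Y.filt i.castSucc) (Y.filt i.succ) (Y.inv _) (Y.inv _) (τ : G) -
          LinearMap.id))
      (gradedMap ρ (Y.filt i.castSucc) (Y.filt i.succ) (Y.inv _) (Y.inv _) g)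

/-- The trace is additive in short exact sequences. -/
theorem trace_eq_add_of_exact {V₁ V₂ : Type*} [AddCommGroup V₁] [Module k V₁]
    [AddCommGroup V₂] [Module k V₂] [FiniteDimensional k V₁] [FiniteDimensional k V]
    [FiniteDimensional k V₂] {f : V₁ →ₗ[k] V} {g : V →ₗ[k] V₂}
    (hf : Function.Injective f) (hg : Function.Surjective g)
    (hfg : LinearMap.range f = LinearMap.ker g)
    {T₁ : V₁ →ₗ[k] V₁} {T : V →ₗ[k] V} {T₂ : V₂ →ₗ[k] V₂}
    (h₁ : ∀ v, f (T₁ v) = T (f v)) (h₂ : ∀ v, g (T v) = T₂ (g v)) :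
    LinearMap.trace k V T = LinearMap.trace k V₁ T₁ + LinearMap.trace k V₂ T₂ := by
  obtain ⟨r, hr⟩ := f.exists_leftInverse_of_injective (LinearMap.ker_eq_bot.mpr hf)
  obtain ⟨s, hs⟩ := g.exists_rightInverse_of_surjective (LinearMap.range_eq_top.mpr hg)
  have hr' (v) : r (f v) = v := LinearMap.congr_fun hr v
  have hs' (v) : g (s v) = v := LinearMap.congr_fun hs v
  have hgf (v) : g (f v) = 0 := by
    rw [← LinearMap.mem_ker, ← hfg]
    exact LinearMap.mem_range_self f v
  have hdecomp (v) : f (r (v - s (g v))) = v - s (g v) := by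
    have : v - s (g v) ∈ LinearMap.range f := by simp [hfg, hs']
    obtain ⟨u, hu⟩ := this
    rw [← hu, hr']
  have hT : T = (T ∘ₗ f) ∘ₗ (r ∘ₗ (LinearMap.id - s ∘ₗ g)) + (T ∘ₗ s) ∘ₗ g := by
    ext v
    have h := congrArg T (hdecomp v)
    simp only [LinearMap.add_apply, LinearMap.comp_apply, LinearMap.sub_apply,
      LinearMap.id_apply, h]
    simp
  have hT₁ : (r ∘ₗ (LinearMap.id - s ∘ₗ g)) ∘ₗ (T ∘ₗ f) = T₁ := by
    ext v
    simp [← h₁, hgf, hr']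
  have hT₂ : g ∘ₗ (T ∘ₗ s) = T₂ := by
    ext v
    simp [h₂, hs']
  conv_lhs => rw [hT]
  rw [map_add, LinearMap.trace_comp_comm' _ (T ∘ₗ f), LinearMap.trace_comp_comm' _ (T ∘ₗ s), hT₁, hT₂]

/-- If `e` is a projection onto `p` and `T` preserves `p`, then the trace of `T` on `p` is
the trace of `T ∘ e`. -/
theorem traceOn_eq_trace_comp [FiniteDimensional k V] {p : Submodule k V} {e T : V →ₗ[k] V}
    (he : LinearMap.IsProj p e) (hT : ∀ v ∈ p, T v ∈ p) :
    traceOn p T = LinearMap.trace k V (T ∘ₗ e) := by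
  rw [traceOn, dif_pos hT]
  have h₁ : T ∘ₗ e = (T ∘ₗ p.subtype) ∘ₗ he.codRestrict := by
    ext v
    simp
  have h₂ : he.codRestrict ∘ₗ (T ∘ₗ p.subtype) = T.restrict hT := by
    ext v
    simpa using he.map_id _ (hT v v.2)
  rw [h₁, LinearMap.trace_comp_comm', h₂]

/-- The trace of `g` on the invariants of a normal subgroup `N` acting through the finite set
`N ⧸ J` is the average of the traces of the elements of the coset `g N`. -/
theorem traceOn_invariants_eq_average [CharZero k] [FiniteDimensional k V]
    (ρ : Representation k G V) (N : Subgroup G) [N.Normal] (J : Subgroup N) [J.FiniteIndex]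
    [Fintype (N ⧸ J)] (hJ : ∀ τ ∈ J, ρ (τ : G) = 1) (g : G) :
    traceOn (⨅ τ : N, LinearMap.ker (ρ (τ : G) - LinearMap.id)) (ρ g) =
      (J.index : k)⁻¹ * ∑ q : N ⧸ J, LinearMap.trace k V (ρ (g * (q.out : N))) := by
  have hmem (v : V) : v ∈ (⨅ τ : N, LinearMap.ker (ρ (τ : G) - LinearMap.id)) ↔
      ∀ τ : N, ρ (τ : G) v = v := by
    simp [Submodule.mem_iInf, sub_eq_zero]
  have hindex : (J.index : k) ≠ 0 := Nat.cast_ne_zero.mpr Subgroup.FiniteIndex.index_ne_zero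
  have hcard : (Fintype.card (N ⧸ J) : k) = J.index := by
    rw [Subgroup.index_eq_card, Nat.card_eq_fintype_card]
  have hcoset (τ : N) (q : N ⧸ J) :
      ρ ((τ • q).out : N) = ρ (τ : G) * ρ (q.out : N) := by
    have hq : (τ * q.out)⁻¹ * (τ • q).out ∈ J := by
      rw [← QuotientGroup.eq]
      conv_rhs => rw [QuotientGroup.out_eq', ← QuotientGroup.out_eq' q]
      rfl
    have h := hJ _ hq
    have hprod : (((τ • q).out : N) : G) =
        (τ : G) * (q.out : N) * (((τ * q.out)⁻¹ * (τ • q).out : N) : G) := by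
      simp [mul_assoc]
    rw [hprod, map_mul, h, map_mul, mul_one]
  let e : V →ₗ[k] V := (J.index : k)⁻¹ • ∑ q : N ⧸ J, ρ (q.out : N)
  have he : LinearMap.IsProj (⨅ τ : N, LinearMap.ker (ρ (τ : G) - LinearMap.id)) e := by
    refine ⟨fun v => (hmem _).mpr fun τ => ?_, fun v hv => ?_⟩
    · have : ρ (τ : G) * e = e := by
        simp only [e, mul_smul_comm, Finset.mul_sum, ← hcoset]
        congr 1
        exact Equiv.sum_comp (MulAction.toPerm τ) fun q : N ⧸ J => ρ (q.out : N)
      exact LinearMap.congr_fun this v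
    · have hv' := (hmem v).mp hv
      simp only [e, LinearMap.smul_apply, LinearMap.sum_apply, hv', Finset.sum_const,
        Finset.card_univ]
      rw [← Nat.cast_smul_eq_nsmul k, hcard, smul_smul, inv_mul_cancel₀ hindex, one_smul]
  have hg (v) (hv : v ∈ (⨅ τ : N, LinearMap.ker (ρ (τ : G) - LinearMap.id))) :
      ρ g v ∈ (⨅ τ : N, LinearMap.ker (ρ (τ : G) - LinearMap.id)) := by
    rw [hmem] at hv ⊢
    intro τ
    have h := hv ⟨g⁻¹ * τ * g, by
      simpa using (inferInstance : N.Normal).conj_mem τ τ.2 g⁻¹⟩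
    conv_rhs => rw [← h]
    simp only [← Module.End.mul_apply, ← map_mul]
    simp [mul_assoc]
  rw [traceOn_eq_trace_comp he hg]
  simp only [e, ← Module.End.mul_eq_comp, mul_smul_comm, Finset.mul_sum, map_smul, map_sum,
    smul_eq_mul, map_mul]

/-- The representation on the graded piece `q / p`. -/
def gradedRep (ρ : Representation k G V) (p q : Submodule k V)
    (hp : IsSubrep ρ p) (hq : IsSubrep ρ q) :
    Representation k G (q ⧸ p.comap q.subtype) where
  toFun := gradedMap ρ p q hp hq
  map_one' := by
    ext v
    simp [gradedMap, LinearMap.restrict_apply]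
  map_mul' x y := by
    ext v
    simp [gradedMap, LinearMap.restrict_apply]

/-- The trace on a representation is the sum of the traces on the graded pieces of a
filtration. -/
theorem AdmissibleFiltration.trace_eq_sum [FiniteDimensional k V] {ρ : Representation k G V}
    {N : Subgroup G} (Y : AdmissibleFiltration ρ N) (g : G) :
    LinearMap.trace k V (ρ g) = ∑ i : Fin Y.len, LinearMap.trace k _
      (gradedMap ρ (Y.filt i.castSucc) (Y.filt i.succ) (Y.inv _) (Y.inv _) g) := by
  let t (i : Fin (Y.len + 1)) : k :=
    LinearMap.trace k (Y.filt i) ((ρ g).restrict fun v hv => Y.inv i g v hv)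
  have hstep (i : Fin Y.len) : LinearMap.trace k _
      (gradedMap ρ (Y.filt i.castSucc) (Y.filt i.succ) (Y.inv _) (Y.inv _) g) =
        t i.succ - t i.castSucc := by
    have hle : Y.filt i.castSucc ≤ Y.filt i.succ := Y.mono i.castSucc_le_succ
    rw [eq_sub_iff_add_eq']
    refine (trace_eq_add_of_exact (f := Submodule.inclusion hle)
      (g := ((Y.filt i.castSucc).comap (Y.filt i.succ).subtype).mkQ)
      (Submodule.inclusion_injective hle) (Submodule.mkQ_surjective _) ?_
      (fun v => rfl) (fun v => rfl)).symm
    rw [Submodule.ker_mkQ, Submodule.range_inclusion]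
  have hbot : t 0 = 0 := by
    have : Subsingleton (Y.filt 0) := by
      rw [Y.bot_eq]
      infer_instance
    have hzero : (ρ g).restrict (fun v hv => Y.inv 0 g v hv) = 0 :=
      LinearMap.ext fun v => Subsingleton.elim _ _
    simp only [t, hzero, map_zero]
  have htop : t (Fin.last _) = LinearMap.trace k V (ρ g) := by
    have hV : Function.Surjective (Y.filt (Fin.last Y.len)).subtype := by
      rw [← LinearMap.range_eq_top, Submodule.range_subtype, Y.top_eq]
    have := trace_eq_add_of_exact (f := (Y.filt (Fin.last Y.len)).subtype)
      (g := (0 : V →ₗ[k] (⊥ : Submodule k V))) (T := ρ g) (T₂ := 0)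
      (T₁ := (ρ g).restrict fun v hv => Y.inv _ g v hv)
      (Submodule.injective_subtype _) (Function.surjective_to_subsingleton _)
      (by rw [LinearMap.ker_zero, LinearMap.range_eq_top.mpr hV]) (fun v => rfl) (fun v => by simp)
    rw [this, map_zero, add_zero]
  simp only [hstep]
  rw [Finset.sum_sub_distrib, ← htop]
  have h := (Fin.sum_univ_succ t).symm.trans (Fin.sum_univ_castSucc t)
  rw [hbot, zero_add] at h
  rw [h]
  ring

/-- The elements of `N` acting trivially on all graded pieces of a filtration. -/
def AdmissibleFiltration.kernel {ρ : Representation k G V} {N : Subgroup G}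
    (Y : AdmissibleFiltration ρ N) : Subgroup N :=
  ⨅ i : Fin Y.len, ((gradedRep ρ (Y.filt i.castSucc) (Y.filt i.succ)
    (Y.inv _) (Y.inv _)).comp N.subtype).ker

instance {ρ : Representation k G V} {N : Subgroup G} (Y : AdmissibleFiltration ρ N) :
    Y.kernel.FiniteIndex := by
  refine Subgroup.finiteIndex_iInf fun i => ?_
  let σ := (gradedRep ρ (Y.filt i.castSucc) (Y.filt i.succ) (Y.inv _) (Y.inv _)).comp N.subtype
  have hσ : Finite (Set.range σ) := Y.adm i
  have : Finite σ.toHomUnits.range := by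
    refine Finite.of_injective
      (fun u => (⟨u.1, u.2.imp fun τ hτ => congrArg Units.val hτ⟩ : Set.range σ)) ?_
    exact fun u v huv => Subtype.ext (Units.ext (congrArg Subtype.val huv))
  have hker : σ.ker = σ.toHomUnits.ker := by
    ext τ
    simp [MonoidHom.mem_ker]
  change σ.ker.FiniteIndex
  rw [hker]
  infer_instance

/-- The semisimple trace is an average of ordinary traces. -/
theorem ssTrace_eq_average [CharZero k] [FiniteDimensional k V] (ρ : Representation k G V)
    (N : Subgroup G) [N.Normal] (Y : AdmissibleFiltration ρ N) (J : Subgroup N) [J.FiniteIndex]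
    [Fintype (N ⧸ J)] (hJ : J ≤ Y.kernel) (g : G) :
    ssTrace ρ N Y g =
      (J.index : k)⁻¹ * ∑ q : N ⧸ J, LinearMap.trace k V (ρ (g * (q.out : N))) := by
  simp only [Y.trace_eq_sum]
  rw [Finset.sum_comm, Finset.mul_sum]
  refine Finset.sum_congr rfl fun i _ => ?_
  exact traceOn_invariants_eq_average
    (gradedRep ρ (Y.filt i.castSucc) (Y.filt i.succ) (Y.inv _) (Y.inv _)) N J
    (fun τ hτ => (Subgroup.mem_iInf.mp (hJ hτ) i)) g

/-- The semisimple trace does not depend on the admissible filtration. -/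
theorem ssTrace_eq_ssTrace [CharZero k] [FiniteDimensional k V] (ρ : Representation k G V)
    (N : Subgroup G) [N.Normal] (Y Y' : AdmissibleFiltration ρ N) (g : G) :
    ssTrace ρ N Y g = ssTrace ρ N Y' g := by
  let J := Y.kernel ⊓ Y'.kernel
  let := Fintype.ofFinite (N ⧸ J)
  rw [ssTrace_eq_average ρ N Y J inf_le_left, ssTrace_eq_average ρ N Y' J inf_le_right]

/-- The semisimple trace is additive in short exact sequences. -/
theorem ssTrace_eq_add_of_exact [CharZero k] [FiniteDimensional k V]
    {V₁ V₂ : Type*} [AddCommGroup V₁] [Module k V₁] [FiniteDimensional k V₁]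
    [AddCommGroup V₂] [Module k V₂] [FiniteDimensional k V₂]
    {ρ : Representation k G V} {ρ₁ : Representation k G V₁} {ρ₂ : Representation k G V₂}
    {N : Subgroup G} [N.Normal] (Y : AdmissibleFiltration ρ N)
    (Y₁ : AdmissibleFiltration ρ₁ N) (Y₂ : AdmissibleFiltration ρ₂ N)
    {f : V₁ →ₗ[k] V} {f' : V →ₗ[k] V₂}
    (hf : ∀ x v, f (ρ₁ x v) = ρ x (f v)) (hf' : ∀ x v, f' (ρ x v) = ρ₂ x (f' v))
    (hinj : Function.Injective f) (hsurj : Function.Surjective f')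
    (hexact : LinearMap.range f = LinearMap.ker f') (g : G) :
    ssTrace ρ N Y g = ssTrace ρ₁ N Y₁ g + ssTrace ρ₂ N Y₂ g := by
  let J := Y.kernel ⊓ (Y₁.kernel ⊓ Y₂.kernel)
  let := Fintype.ofFinite (N ⧸ J)
  rw [ssTrace_eq_average ρ N Y J inf_le_left,
    ssTrace_eq_average ρ₁ N Y₁ J (inf_le_right.trans inf_le_left),
    ssTrace_eq_average ρ₂ N Y₂ J (inf_le_right.trans inf_le_right),
    ← mul_add, ← Finset.sum_add_distrib]
  congr 1
  exact Finset.sum_congr rfl fun q _ => trace_eq_add_of_exact hinj hsurj hexact (hf _) (hf' _)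

/-- Well-definedness and additivity of the semisimple trace.  `H` is a finite group, `W` a
group with a normal subgroup `I` (modelling the Weil group with inertia), and all
representations of `H × W` are finite dimensional over `ℂ` (≅ `ℚ̄_ℓ`) and admit admissible
filtrations (filtrations on whose graded pieces `{1} × I` acts through a finite quotient).
(1) The semisimple trace `tr^ss(h × w | Y)` does not depend on the chosen admissible
filtration.  (2) It is additive in short exact sequences `0 → V₁ → V → V₂ → 0` of such
representations. -/
theorem semisimple_trace_well_defined_and_additive
    {H W : Type*} [Group H] [Finite H] [Group W] (I : Subgroup W) [I.Normal]
    {V : Type*} [AddCommGroup V] [Module ℂ V] [FiniteDimensional ℂ V]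
    (ρ : Representation ℂ (H × W) V)
    (Y Y' : AdmissibleFiltration ρ ((⊥ : Subgroup H).prod I))
    {V₁ : Type*} [AddCommGroup V₁] [Module ℂ V₁] [FiniteDimensional ℂ V₁]
    {V₂ : Type*} [AddCommGroup V₂] [Module ℂ V₂] [FiniteDimensional ℂ V₂]
    (ρ₁ : Representation ℂ (H × W) V₁) (ρ₂ : Representation ℂ (H × W) V₂)
    (Y₁ : AdmissibleFiltration ρ₁ ((⊥ : Subgroup H).prod I))
    (Y₂ : AdmissibleFiltration ρ₂ ((⊥ : Subgroup H).prod I))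
    (f : V₁ →ₗ[ℂ] V) (g : V →ₗ[ℂ] V₂)
    (hf : ∀ x v, f (ρ₁ x v) = ρ x (f v)) (hg : ∀ x v, g (ρ x v) = ρ₂ x (g v))
    (hinj : Function.Injective f) (hsurj : Function.Surjective g)
    (hexact : LinearMap.range f = LinearMap.ker g) :
    (∀ (h : H) (w : W),
      ssTrace ρ ((⊥ : Subgroup H).prod I) Y (h, w) =
        ssTrace ρ ((⊥ : Subgroup H).prod I) Y' (h, w)) ∧
    (∀ (h : H) (w : W),
      ssTrace ρ ((⊥ : Subgroup H).prod I) Y (h, w) =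
        ssTrace ρ₁ ((⊥ : Subgroup H).prod I) Y₁ (h, w) +
          ssTrace ρ₂ ((⊥ : Subgroup H).prod I) Y₂ (h, w)) := by
  have : ((⊥ : Subgroup H).prod I).Normal := Subgroup.prod_normal _ _
  exact ⟨fun h w => ssTrace_eq_ssTrace ρ _ Y Y' (h, w),
    fun h w => ssTrace_eq_add_of_exact Y Y₁ Y₂ hf hg hinj hsurj hexact (h, w)⟩
end
end

section
/- Let F be a local field of characteristic p with ring of integers O, uniformizer ϖ, residue field of cardinality q. Let O_r be the ring of integers of the degree-r unramified extension F_r, and σ the q-Frobenius. The norm map N(δ) = δ·σ(δ)·⋯·σ^{r−1}(δ) induces a bijection from the set of GL_n(O_r)-σ-conjugacy classes in GL_n(O_r) to the set of GL_n(O)-conjugacy classes in GL_n(O). -/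
noncomputable section

theorem card_injective_linearMap_eq {R : Type*} [Ring R] {M N : Type} [AddCommGroup M]
    [AddCommGroup N] [Module R M] [Module R N] [Finite M] [Finite N]
    (h : ∀ (X : Type) [AddCommGroup X] [Module R X] [Finite X],
      Nat.card (X →ₗ[R] M) = Nat.card (X →ₗ[R] N)) (k : ℕ) :
    ∀ (X : Type) [AddCommGroup X] [Module R X] [Finite X], Nat.card X = k →
      Nat.card {f : X →ₗ[R] M // LinearMap.ker f = ⊥} =
        Nat.card {f : X →ₗ[R] N // LinearMap.ker f = ⊥} := by
  induction k using Nat.strong_induction_on with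
  | _ k ih =>
  intro X _ _ _ hX
  classical
  have finHom : ∀ (P : Type) [AddCommGroup P] [Module R P] [Finite P],
      Finite (X →ₗ[R] P) := fun P _ _ _ => Finite.of_injective _ DFunLike.coe_injective
  have := finHom M
  have := finHom N
  have : Finite (Submodule R X) := Finite.of_injective _ (SetLike.coe_injective)
  have := Fintype.ofFinite (Submodule R X)
  have split : ∀ (P : Type) [AddCommGroup P] [Module R P] [Finite P],
      Nat.card (X →ₗ[R] P) = ∑ Y : Submodule R X, Nat.card {f : X →ₗ[R] P // LinearMap.ker f = Y} := by
    intro P _ _ _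
    have := finHom P
    rw [← Nat.card_sigma]
    exact Nat.card_congr (Equiv.sigmaFiberEquiv _).symm
  have quot : ∀ (P : Type) [AddCommGroup P] [Module R P] [Finite P] (Y : Submodule R X),
      Nat.card {f : X →ₗ[R] P // LinearMap.ker f = Y} =
        Nat.card {f : (X ⧸ Y) →ₗ[R] P // LinearMap.ker f = ⊥} := by
    intro P _ _ _ Y
    refine Nat.card_congr
      { toFun := fun f => ⟨Y.liftQ f.1 f.2.ge, ?_⟩
        invFun := fun g => ⟨g.1.comp Y.mkQ, ?_⟩
        left_inv := ?_
        right_inv := ?_ }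
    · exact Submodule.ker_liftQ_eq_bot _ _ _ f.2.le
    · rw [LinearMap.ker_comp, g.2]
      exact Submodule.ker_mkQ Y
    · intro f
      ext x
      rfl
    · intro g
      ext x
      rfl
  have key := h X
  rw [split M, split N, ← Finset.add_sum_erase _ _ (Finset.mem_univ (⊥ : Submodule R X)),
    ← Finset.add_sum_erase _ _ (Finset.mem_univ (⊥ : Submodule R X))] at key
  refine Nat.add_right_cancel (key.trans (congrArg _ (Finset.sum_congr rfl fun Y hY => ?_)).symm)
  have : Finite (X ⧸ Y) := Finite.of_surjective Y.mkQ Y.mkQ_surjective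
  rw [quot M, quot N]
  refine ih _ ?_ (X ⧸ Y) rfl
  rw [← hX, Submodule.card_eq_card_quotient_mul_card Y]
  have hY' : Y ≠ ⊥ := Finset.ne_of_mem_erase hY
  have := (Submodule.nontrivial_iff_ne_bot).2 hY'
  exact lt_mul_of_one_lt_left Nat.card_pos (Finite.one_lt_card (α := Y))

/-- Cancellation of powers for finite modules. -/
theorem nonempty_linearEquiv_of_pi {R : Type*} [Ring R] {M N : Type} [AddCommGroup M]
    [AddCommGroup N] [Module R M] [Module R N] [Finite M] [Finite N] {r : ℕ} (hr : 0 < r)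
    (e : (Fin r → M) ≃ₗ[R] (Fin r → N)) : Nonempty (M ≃ₗ[R] N) := by
  have hcard : ∀ (X : Type) [AddCommGroup X] [Module R X] [Finite X],
      Nat.card (X →ₗ[R] M) = Nat.card (X →ₗ[R] N) := by
    intro X _ _ _
    have hpow : ∀ (P : Type) [AddCommGroup P] [Module R P],
        Nat.card (X →ₗ[R] (Fin r → P)) = Nat.card (X →ₗ[R] P) ^ r := by
      intro P _ _
      let E : (X →ₗ[R] (Fin r → P)) ≃ (Fin r → X →ₗ[R] P) :=
        { toFun := fun f i => (LinearMap.proj i).comp f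
          invFun := fun f => LinearMap.pi f
          left_inv := fun f => by ext; rfl
          right_inv := fun f => by ext; rfl }
      rw [Nat.card_congr E]
      simp [Nat.card_fun]
    refine Nat.pow_left_injective hr.ne' ?_
    dsimp only
    rw [← hpow, ← hpow]
    exact Nat.card_congr
      { toFun := fun f => e.toLinearMap.comp f
        invFun := fun f => e.symm.toLinearMap.comp f
        left_inv := fun f => by ext; simp
        right_inv := fun f => by ext; simp }
  have hMN : Nat.card M = Nat.card N := by
    refine Nat.pow_left_injective hr.ne' ?_
    simpa [Nat.card_fun] using Nat.card_congr e.toEquiv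
  have hinj := card_injective_linearMap_eq hcard _ M rfl
  have : Finite (M →ₗ[R] M) := Finite.of_injective _ DFunLike.coe_injective
  have : Nonempty {f : M →ₗ[R] M // LinearMap.ker f = ⊥} := ⟨⟨LinearMap.id, LinearMap.ker_id⟩⟩
  have hpos : 0 < Nat.card {f : M →ₗ[R] N // LinearMap.ker f = ⊥} := hinj ▸ Nat.card_pos
  obtain ⟨f, hf⟩ := (Nat.card_pos_iff.1 hpos).1
  exact ⟨LinearEquiv.ofBijective f
    ((Nat.bijective_iff_injective_and_card f).2 ⟨LinearMap.ker_eq_bot.1 hf, hMN⟩)⟩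

/-- A basis of `K` over its subfield fixed by `σ`, with its dual basis for the trace form,
expressed through the powers of `σ`. -/
structure CyclicDualBases {K : Type} [Field K] (σ : K →+* K) (r : ℕ) (a b : Fin r → K) : Prop where
  sum_iterate_mul : ∀ i k, ∑ j ∈ Finset.range r, σ^[j] (a i * b k) = if i = k then 1 else 0
  sum_mul_iterate : ∀ j ∈ Finset.range r, ∑ i, b i * σ^[j] (a i) = if j = 0 then 1 else 0

theorem iterate_frobenius_apply {K : Type} [Field K] {q : ℕ} (σ : K →+* K)
    (hσ : ∀ x, σ x = x ^ q) (j : ℕ) (x : K) : σ^[j] x = x ^ q ^ j := by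
  induction j with
  | zero => simp
  | succ j ih => rw [Function.iterate_succ_apply', ih, hσ, ← pow_mul, pow_succ]

theorem exists_cyclicDualBases {κ K : Type} [Field κ] [Finite κ] [Field K] [Finite K] [Algebra κ K]
    {r : ℕ} (hr : Module.finrank κ K = r) (σ : K →+* K) (hσ : ∀ x, σ x = x ^ Nat.card κ) :
    ∃ a b, CyclicDualBases σ r a b := by
  subst hr
  let b := Module.finBasis κ K
  let a := (Algebra.traceForm κ K).dualBasis (traceForm_nondegenerate κ K) b
  have h1 : ∀ i k, ∑ j ∈ Finset.range (Module.finrank κ K), σ^[j] (a i * b k) =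
      if i = k then 1 else 0 := by
    intro i k
    simp only [iterate_frobenius_apply σ hσ]
    rw [← FiniteField.algebraMap_trace_eq_sum_pow, ← Algebra.traceForm_apply,
      LinearMap.BilinForm.apply_dualBasis_left]
    simp [eq_comm]
  refine ⟨a, b, h1, fun j hj => ?_⟩
  let U : Matrix (Fin (Module.finrank κ K)) (Fin (Module.finrank κ K)) K :=
    .of fun j i => σ^[j] (b i)
  let V : Matrix (Fin (Module.finrank κ K)) (Fin (Module.finrank κ K)) K :=
    .of fun i j => σ^[j] (a i)
  have hVU : V * U = 1 := by
    ext i k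
    rw [Matrix.mul_apply, Matrix.one_apply, ← h1, Finset.sum_range]
    simp [U, V, iterate_map_mul]
  have hUV := mul_eq_one_comm.1 hVU
  have hj' := Finset.mem_range.1 hj
  have := congrFun (congrFun hUV ⟨0, by omega⟩) ⟨j, hj'⟩
  rw [Matrix.mul_apply, Matrix.one_apply] at this
  simpa [U, V, Fin.ext_iff, eq_comm] using this

theorem frobenius_iterate_finrank {κ K : Type} [Field κ] [Finite κ] [Field K] [Finite K]
    [Algebra κ K] (σ : K →+* K) (hσ : ∀ x, σ x = x ^ Nat.card κ) (x : K) :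
    σ^[Module.finrank κ K] x = x := by
  have := Fintype.ofFinite K
  rw [iterate_frobenius_apply σ hσ, ← Module.natCard_eq_pow_finrank, Nat.card_eq_fintype_card,
    FiniteField.pow_card]

theorem mem_range_algebraMap_of_frobenius_eq {κ K : Type} [Field κ] [Finite κ] [Field K]
    [Finite K] [Algebra κ K] (σ : K →+* K) (hσ : ∀ x, σ x = x ^ Nat.card κ) (x : K)
    (hx : σ x = x) : x ∈ (algebraMap κ K).range := by
  obtain ⟨t, ht⟩ := Algebra.trace_surjective κ K 1
  refine ⟨Algebra.trace κ K (t * x), ?_⟩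
  have h1 := FiniteField.algebraMap_trace_eq_sum_pow κ K t
  rw [ht, map_one] at h1
  rw [FiniteField.algebraMap_trace_eq_sum_pow]
  simp only [← iterate_frobenius_apply σ hσ] at h1 ⊢
  simp only [iterate_map_mul, Function.iterate_fixed hx, ← Finset.sum_mul, ← h1, one_mul]

section
variable {K : Type} [Field K] {σ : K →+* K} {r : ℕ} {a b : Fin r → K}

theorem iterate_smul {B : Type} [AddCommGroup B] [Module K B] (φ : B → B)
    (hφ : ∀ (t : K) x, φ (t • x) = σ t • φ x) (j : ℕ) (t : K) (x : B) :
    φ^[j] (t • x) = σ^[j] t • φ^[j] x := by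
  induction j with
  | zero => rfl
  | succ j ih => simp only [Function.iterate_succ_apply', ih, hφ]

theorem iterate_map_sum {B I : Type} [AddCommGroup B] (φ : B →+ B) (j : ℕ) (s : Finset I)
    (f : I → B) : φ^[j] (∑ i ∈ s, f i) = ∑ i ∈ s, φ^[j] (f i) := by
  induction j with
  | zero => rfl
  | succ j ih => simp only [Function.iterate_succ_apply', ih, map_sum]

theorem map_sum_iterate {B : Type} [AddCommGroup B] (φ : B →+ B) (hr : φ^[r] = id) (x : B) :
    φ (∑ j ∈ Finset.range r, φ^[j] x) = ∑ j ∈ Finset.range r, φ^[j] x := by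
  rw [map_sum]
  simp only [← Function.iterate_succ_apply' φ]
  have h := Finset.sum_range_succ (fun j => φ^[j] x) r
  rw [Finset.sum_range_succ', hr] at h
  exact add_right_cancel h

/-- Galois descent along a cyclic extension, for semilinear actions compatible with a module

structure over a ring of fixed scalars. -/
theorem CyclicDualBases.nonempty_linearEquiv (hab : CyclicDualBases σ r a b) (hr0 : 0 < r)
    {B S : Type} [AddCommGroup B] [Module K B] [Ring S] [Module S B] [SMulCommClass S K B]
    (φ : B →+ B) (hφ : ∀ (t : K) x, φ (t • x) = σ t • φ x) (hr : φ^[r] = id)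
    (M : Submodule S B) (hM : ∀ x, x ∈ M ↔ φ x = x) :
    ∃ e : (Fin r → M) ≃ₗ[S] B, ∀ m, e m = ∑ i, b i • (m i : B) := by
  let f : (Fin r → M) →ₗ[S] B :=
    { toFun := fun m => ∑ i, b i • (m i : B)
      map_add' := fun m m' => by simp [Finset.sum_add_distrib]
      map_smul' := fun s m => by simp [Finset.smul_sum, smul_comm s] }
  have hfix : ∀ m ∈ M, ∀ j, φ^[j] m = m := fun m hm j =>
    Function.iterate_fixed ((hM m).1 hm) j
  refine ⟨LinearEquiv.ofBijective f ⟨?_, ?_⟩, fun _ => rfl⟩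
  · refine (injective_iff_map_eq_zero f).2 fun m hm => ?_
    ext k
    have h0 : ∑ j ∈ Finset.range r, φ^[j] (a k • ∑ i, b i • (m i : B)) = 0 := by
      have : ∑ i, b i • (m i : B) = 0 := hm
      simp [this, iterate_map_zero]
    have h1 : ∑ j ∈ Finset.range r, φ^[j] (a k • ∑ i, b i • (m i : B)) = m k := by
      simp only [Finset.smul_sum, smul_smul]
      have : ∀ j, φ^[j] (∑ i, (a k * b i) • (m i : B)) = ∑ i, σ^[j] (a k * b i) • (m i : B) := by
        intro j
        rw [iterate_map_sum]
        simp only [iterate_smul φ hφ, hfix _ (m _).2]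
      simp only [this]
      rw [Finset.sum_comm]
      simp only [← Finset.sum_smul, hab.sum_iterate_mul]
      simp
    rw [h1] at h0
    simpa using h0
  · intro x
    refine ⟨fun i => ⟨∑ j ∈ Finset.range r, φ^[j] (a i • x), (hM _).2 (map_sum_iterate φ hr _)⟩, ?_⟩
    change ∑ i, b i • ∑ j ∈ Finset.range r, φ^[j] (a i • x) = x
    simp only [iterate_smul φ hφ, Finset.smul_sum, smul_smul]
    rw [Finset.sum_comm]
    simp only [← Finset.sum_smul]
    rw [Finset.sum_congr rfl fun j hj => by rw [hab.sum_mul_iterate j hj]]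
    simp [ite_smul, hr0]

/-- Hilbert 90 for a finite algebra with a semilinear automorphism. -/
theorem CyclicDualBases.exists_unit_of_finite (hab : CyclicDualBases σ r a b) (hr : 0 < r)
    {B : Type} [Ring B] [Finite B] [Algebra K B] (ψ : B →+* B)
    (hψ : ∀ (t : K) x, ψ (t • x) = σ t • ψ x) (hψr : ψ^[r] = id) (c : B)
    (hc : (fun x => ψ x * c)^[r] = id) : ∃ u, IsUnit u ∧ ψ u * c = u := by
  let S := ψ.eqLocus (RingHom.id B)
  have hS : ∀ s : S, ψ s = s := fun s => s.2
  let φ : B →+ B := (AddMonoidHom.mulRight c).comp ψ.toAddMonoidHom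
  let M : Submodule S B :=
    { φ.eqLocusM (AddMonoidHom.id B) with
      smul_mem' := fun s x hx => by
        change ψ ((s : B) * x) * c = s * x
        rw [map_mul, hS, mul_assoc]
        exact congrArg _ hx }
  let N : Submodule S B :=
    { ψ.toAddMonoidHom.eqLocusM (AddMonoidHom.id B) with
      smul_mem' := fun s x hx => by
        change ψ ((s : B) * x) = s * x
        rw [map_mul, hS]
        exact congrArg _ hx }
  obtain ⟨e₁, he₁⟩ := hab.nonempty_linearEquiv hr φ
    (fun t x => by simp [φ, hψ]) hc M (fun x => Iff.rfl)
  obtain ⟨e₂, he₂⟩ := hab.nonempty_linearEquiv hr ψ.toAddMonoidHom hψ hψr N (fun x => Iff.rfl)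
  obtain ⟨e⟩ := nonempty_linearEquiv_of_pi hr (e₁.trans e₂.symm)
  let u : M := e.symm ⟨1, map_one ψ⟩
  have hu : ∀ m : M, ∃ s : B, (m : B) = s * u := fun m => by
    refine ⟨e m, ?_⟩
    have : m = (⟨e m, (e m).2⟩ : S) • u := by
      rw [← map_smul, LinearEquiv.eq_symm_apply]
      ext
      simp [Subring.smul_def]
    exact congrArg Subtype.val this
  choose s hs using hu
  have h1 : (∑ i, b i • s (e₁.symm 1 i)) * u = 1 := by
    rw [Finset.sum_mul]
    simp only [smul_mul_assoc, ← hs]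
    rw [← he₁, LinearEquiv.apply_symm_apply]
  exact ⟨u, IsUnit.of_mul_eq_one_right _ h1, u.2⟩

theorem iterate_mul_const {B : Type} [Monoid B] (ψ : B → B) (hψ : ∀ x y, ψ (x * y) = ψ x * ψ y)
    (n : ℕ) (c : ℕ → B) (hc0 : c 0 = 1) (hc : ∀ j, c (j + 1) = ψ (c j) * c 1) (x : B) :
    (fun x => ψ x * c 1)^[n] x = ψ^[n] x * c n := by
  induction n with
  | zero => simp [hc0]
  | succ n ih => simp only [Function.iterate_succ_apply', ih, hψ, hc n, mul_assoc]

/-- Hilbert 90 modulo an ideal of finite index, with a fixed lift of the solution. -/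
theorem CyclicDualBases.exists_fixed_isUnit_mk (hab : CyclicDualBases σ r a b) (hr : 0 < r)
    {B : Type} [Ring B] [Algebra K B] (ψ : B →+* B)
    (hψ : ∀ (t : K) x, ψ (t • x) = σ t • ψ x) (hψr : ψ^[r] = id) (c : B)
    (hc : (fun x => ψ x * c)^[r] = id) (J : Ideal B) [J.IsTwoSided] [Finite (B ⧸ J)]
    (hJ : J ≤ J.comap ψ) : ∃ x, ψ x * c = x ∧ IsUnit (Ideal.Quotient.mk J x) := by
  let π := Ideal.Quotient.mk J
  have hπ : Function.Surjective π := Ideal.Quotient.mk_surjective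
  have hπs : ∀ (t : K) x, π (t • x) = t • π x := fun _ _ => rfl
  let ψ' : B ⧸ J →+* B ⧸ J := Ideal.quotientMap J ψ hJ
  let φ : B →+ B := (AddMonoidHom.mulRight c).comp ψ.toAddMonoidHom
  have hφ : ∀ x, φ x = ψ x * c := fun _ => rfl
  have h1 : Function.Semiconj π ψ ψ' := fun x => rfl
  have h2 : Function.Semiconj π φ (fun x => ψ' x * π c) := fun x => map_mul π _ _
  obtain ⟨u, hu, hfix⟩ := hab.exists_unit_of_finite hr ψ'
    (fun t x => by
      obtain ⟨x, rfl⟩ := hπ x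
      rw [← hπs, ← h1, hψ, hπs, h1])
    (by
      funext x
      obtain ⟨x, rfl⟩ := hπ x
      rw [← (h1.iterate_right r).eq, hψr]
      rfl) (π c)
    (by
      funext x
      obtain ⟨x, rfl⟩ := hπ x
      rw [← (h2.iterate_right r).eq]
      exact congrArg π (congrFun hc x))
  obtain ⟨x, rfl⟩ := hπ u
  let t := a ⟨0, hr⟩ * b ⟨0, hr⟩
  have ht : ∑ j ∈ Finset.range r, σ^[j] t = 1 := by
    rw [hab.sum_iterate_mul]
    simp
  refine ⟨∑ j ∈ Finset.range r, φ^[j] (t • x), map_sum_iterate φ hc _, ?_⟩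
  have : Ideal.Quotient.mk J (∑ j ∈ Finset.range r, φ^[j] (t • x)) = π x := by
    change π _ = _
    have hs : ∀ (t : K) x, φ (t • x) = σ t • φ x := fun t x => by simp [hφ, hψ]
    have hx : ∀ j, π (φ^[j] x) = π x := fun j => by
      rw [(h2.iterate_right j).eq, Function.iterate_fixed hfix]
    simp only [map_sum, iterate_smul (K := K) (σ := σ) φ hs, hπs, hx, ← Finset.sum_smul, ht, one_smul]
  rwa [this]

theorem prod_range_shift {B : Type} [CommMonoid B] (f : ℕ → B) {r : ℕ} (h : f r = f 0) :
    ∏ j ∈ Finset.range r, f (j + 1) = ∏ j ∈ Finset.range r, f j := by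
  cases r with
  | zero => rfl
  | succ r => rw [Finset.prod_range_succ, Finset.prod_range_succ', h]

/-- The norm is surjective onto fixed units of a finite commutative algebra. -/
theorem CyclicDualBases.exists_norm_eq_of_finite (hab : CyclicDualBases σ r a b) (hr : 0 < r)
    {B : Type} [CommRing B] [Finite B] [Algebra K B] (ψ : B →+* B)
    (hψ : ∀ (t : K) x, ψ (t • x) = σ t • ψ x) (hψr : ψ^[r] = id) (u : Bˣ) (hu : ψ u = u) :
    ∃ p, ∏ j ∈ Finset.range r, ψ^[j] p = u := by
  let Ψ : Bˣ →* Bˣ := Units.map ψ.toMonoidHom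
  have hΨ : ∀ j (x : Bˣ), ((Ψ^[j] x : Bˣ) : B) = ψ^[j] x := fun j x => by
    induction j with
    | zero => rfl
    | succ j ih => rw [Function.iterate_succ_apply', Function.iterate_succ_apply', ← ih]; rfl
  let N : Bˣ →* Bˣ :=
    { toFun := fun x => ∏ j ∈ Finset.range r, Ψ^[j] x
      map_one' := by simp [iterate_map_one]
      map_mul' := fun x y => by simp [iterate_map_mul, Finset.prod_mul_distrib] }
  let D : Bˣ →* Bˣ := Ψ / MonoidHom.id _
  have hNfix : ∀ x, Ψ (N x) = N x := fun x => by
    change Ψ (∏ j ∈ Finset.range r, Ψ^[j] x) = ∏ j ∈ Finset.range r, Ψ^[j] x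
    rw [map_prod]
    simp only [← Function.iterate_succ_apply' Ψ]
    refine prod_range_shift (fun j => Ψ^[j] x) (Units.ext ?_)
    rw [hΨ, hψr]
    rfl
  have h1 : N.range ≤ D.ker := by
    rintro _ ⟨x, rfl⟩
    exact div_eq_one.2 (hNfix x)
  have h2 : N.ker ≤ D.range := by
    intro c hc
    have hc' : ∏ j ∈ Finset.range r, Ψ^[j] c = 1 := hc
    have hφ : (fun x => ψ x * (c : B))^[r] = id := by
      funext x
      have := iterate_mul_const ψ (map_mul ψ) r (fun n => ∏ j ∈ Finset.range n, ψ^[j] (c : B))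
        (by simp) (fun j => by
          rw [Finset.prod_range_succ', map_prod]
          simp [← Function.iterate_succ_apply' ψ]) x
      simp only [Finset.prod_range_one, Function.iterate_zero, id] at this
      rw [this, hψr]
      simp only [← hΨ, ← Units.coe_prod, hc']
      simp
    obtain ⟨_, ⟨v, rfl⟩, hv⟩ := hab.exists_unit_of_finite hr ψ hψ hψr c hφ
    refine ⟨v⁻¹, ?_⟩
    have : Ψ v * c = v := Units.ext hv
    change Ψ v⁻¹ / v⁻¹ = c
    rw [map_inv, div_inv_eq_mul, inv_mul_eq_iff_eq_mul, this]
  have hN := Subgroup.card_eq_card_quotient_mul_card_subgroup N.ker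
  have hD := Subgroup.card_eq_card_quotient_mul_card_subgroup D.ker
  rw [Nat.card_congr (QuotientGroup.quotientKerEquivRange _).toEquiv] at hN hD
  have h3 : Nat.card D.ker ≤ Nat.card N.range := by
    have h4 : Nat.card N.ker ≤ Nat.card D.range := Subgroup.card_le_of_le h2
    have h5 : 0 < Nat.card D.range := Nat.card_pos
    rw [hN] at hD
    nlinarith
  have h6 : u ∈ N.range := by
    rw [Subgroup.eq_of_le_of_card_ge h1 h3]
    exact div_eq_one.2 (Units.ext hu)
  obtain ⟨p, hp⟩ := h6
  refine ⟨p, ?_⟩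
  rw [← hp]
  simp [N, hΨ]

theorem eq_of_eval_eq_of_mem_jacobson {A : Type} [CommRing A] {J : Ideal A}
    (hJ : J ≤ Ideal.jacobson ⊥) (f : Polynomial A) {x y : A} (hx : x ∈ J) (hy : y ∈ J)
    (hf : f.eval x = f.eval y) (hf' : IsUnit (Ideal.Quotient.mk J (f.derivative.eval 0))) :
    x = y := by
  have := isLocalHom_of_le_jacobson_bot J hJ
  obtain ⟨k, hk⟩ := f.binomExpansion x (y - x)
  rw [add_sub_cancel, ← hf, add_assoc, left_eq_add, sq, ← mul_assoc, ← add_mul] at hk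
  have hunit : IsUnit (f.derivative.eval x + k * (y - x)) := by
    refine isUnit_of_map_unit (Ideal.Quotient.mk J) _ ?_
    have h0 : Ideal.Quotient.mk J x = 0 := Ideal.Quotient.eq_zero_iff_mem.2 hx
    have h1 : Ideal.Quotient.mk J y = 0 := Ideal.Quotient.eq_zero_iff_mem.2 hy
    rw [map_add, map_mul, map_sub, h0, h1, sub_zero, mul_zero, add_zero]
    rw [← Polynomial.eval₂_at_apply, ← Polynomial.eval_map] at hf' ⊢
    rwa [h0]
  exact (sub_eq_zero.1 ((hunit.mul_right_eq_zero).1 hk)).symm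

/-- The norm is surjective onto fixed units of a Henselian commutative algebra with finite
residue ring. -/
theorem CyclicDualBases.exists_norm_eq (hab : CyclicDualBases σ r a b) (hr : 0 < r)
    (hσr : σ^[r] = id) {A : Type} [CommRing A] [Algebra K A] (ψ : A →+* A)
    (hψ : ∀ (t : K) x, ψ (t • x) = σ t • ψ x) (hψr : ψ^[r] = id)
    (J : Ideal A) [HenselianRing A J] [Finite (A ⧸ J)] (hJ : J ≤ J.comap ψ)
    (u : Aˣ) (hu : ψ u = u) : ∃ p, ∏ j ∈ Finset.range r, ψ^[j] p = u := by
  rcases subsingleton_or_nontrivial A with _ | _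
  · exact ⟨1, Subsingleton.elim _ _⟩
  have hjac : J ≤ Ideal.jacobson ⊥ := HenselianRing.jac
  have := isLocalHom_of_le_jacobson_bot J hjac
  let π := Ideal.Quotient.mk J
  have hπ : Function.Surjective π := Ideal.Quotient.mk_surjective
  have hπs : ∀ (t : K) x, π (t • x) = t • π x := fun _ _ => rfl
  let ψ' : A ⧸ J →+* A ⧸ J := Ideal.quotientMap J ψ hJ
  have h1 : Function.Semiconj π ψ ψ' := fun x => rfl
  obtain ⟨p₀, hp₀⟩ := hab.exists_norm_eq_of_finite hr ψ'
    (fun t x => by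
      obtain ⟨x, rfl⟩ := hπ x
      rw [← hπs, ← h1, hψ, hπs, h1])
    (by
      funext x
      obtain ⟨x, rfl⟩ := hπ x
      rw [← (h1.iterate_right r).eq, hψr]
      rfl) (Units.map π.toMonoidHom u) (congrArg π hu)
  obtain ⟨p₀, rfl⟩ := hπ p₀
  simp only [← (h1.iterate_right _).eq, ← map_prod] at hp₀
  have hfixprod : ∀ p, ψ (∏ j ∈ Finset.range r, ψ^[j] p) = ∏ j ∈ Finset.range r, ψ^[j] p := by
    intro p
    rw [map_prod]
    simp only [← Function.iterate_succ_apply' ψ]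
    refine prod_range_shift (fun j => ψ^[j] p) ?_
    rw [hψr]
    rfl
  have hunit : IsUnit (∏ j ∈ Finset.range r, ψ^[j] p₀) :=
    isUnit_of_map_unit π _ (by rw [hp₀]; exact Units.isUnit _)
  obtain ⟨v, hv⟩ := hunit
  have hvfix : ψ v = v := by rw [hv, hfixprod]
  have hvfix' : ψ ↑v⁻¹ = ↑v⁻¹ := by
    have : Units.map ψ.toMonoidHom v = v := Units.ext hvfix
    calc ψ ↑v⁻¹ = ((Units.map ψ.toMonoidHom v)⁻¹ : Aˣ) := rfl
      _ = ↑v⁻¹ := by rw [this]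
  let w : A := u * ↑v⁻¹
  have hwfix : ψ w = w := by simp only [w, map_mul, hu, hvfix']
  have hπw : π w = 1 := by
    have : π v = π u := by rw [hv, hp₀]; rfl
    simp only [w, map_mul, ← this]
    rw [← map_mul, Units.mul_inv, map_one]
  let t := a ⟨0, hr⟩ * b ⟨0, hr⟩
  have ht : ∑ j ∈ Finset.range r, σ^[j] t = 1 := by
    rw [hab.sum_iterate_mul]
    simp
  have ht0 : t ≠ 0 := by
    intro h
    simp [h, iterate_map_zero] at ht
  have hσt : ∀ j, σ^[j] t⁻¹ = (σ^[j] t)⁻¹ := fun j => by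
    induction j with
    | zero => rfl
    | succ j ih => rw [Function.iterate_succ_apply', Function.iterate_succ_apply', ih, map_inv₀]
  have hσt0 : ∀ j, σ^[j] t ≠ 0 := fun j => by
    induction j with
    | zero => exact ht0
    | succ j ih => rwa [Function.iterate_succ_apply', map_ne_zero]
  have hψalg : ∀ s : K, ψ (algebraMap K A s) = algebraMap K A (σ s) := fun s => by
    rw [Algebra.algebraMap_eq_smul_one, hψ, map_one, Algebra.algebraMap_eq_smul_one]
  have hψalg' : ∀ j (s : K), ψ^[j] (algebraMap K A s) = algebraMap K A (σ^[j] s) := fun j s =>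
    ((Function.Semiconj.iterate_right (f := algebraMap K A) (ga := σ) (gb := ψ)
      (fun s => (hψalg s).symm) j).eq s).symm
  let n : K := ∏ j ∈ Finset.range r, σ^[j] t
  have hn0 : n ≠ 0 := Finset.prod_ne_zero_iff.2 fun j _ => hσt0 j
  have hσn : σ n = n := by
    simp only [n, map_prod, ← Function.iterate_succ_apply' σ]
    refine prod_range_shift (fun j => σ^[j] t) ?_
    rw [hσr]
    rfl
  have hσn' : σ n⁻¹ = n⁻¹ := by rw [map_inv₀, hσn]
  let g : Polynomial A :=
    ∏ j ∈ Finset.range r, (Polynomial.X + Polynomial.C (algebraMap K A (σ^[j] t⁻¹)))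
  let f : Polynomial A := g - Polynomial.C (algebraMap K A n⁻¹ * w)
  have hg : g.Monic := Polynomial.monic_prod_of_monic _ _ fun j _ => Polynomial.monic_X_add_C _
  have hgdeg : g.natDegree = r := by
    rw [Polynomial.natDegree_prod_of_monic _ _ fun j _ => Polynomial.monic_X_add_C _]
    simp
  have hf : f.Monic := hg.sub_of_left <| by
    refine Polynomial.degree_C_le.trans_lt (Polynomial.natDegree_pos_iff_degree_pos.1 ?_)
    rwa [hgdeg]
  have hf0 : f.eval 0 ∈ J := by
    refine Ideal.Quotient.eq_zero_iff_mem.1 ?_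
    change π _ = 0
    simp only [f, g, Polynomial.eval_sub, Polynomial.eval_prod, Polynomial.eval_add,
      Polynomial.eval_X, Polynomial.eval_C, zero_add]
    rw [map_sub, map_mul π, hπw, mul_one, ← map_prod, sub_eq_zero]
    simp [hσt, n]
  have hf' : f.derivative.eval 0 = algebraMap K A n⁻¹ := by
    have : ∀ i ∈ Finset.range r, ∏ j ∈ (Finset.range r).erase i, σ^[j] t⁻¹ = n⁻¹ * σ^[i] t := by
      intro i hi
      have h := Finset.mul_prod_erase _ (fun j => σ^[j] t⁻¹) hi
      have hn : ∏ j ∈ Finset.range r, σ^[j] t⁻¹ = n⁻¹ := by simp [hσt, n]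
      rw [← hn, ← h, hσt, mul_comm, ← mul_assoc, mul_inv_cancel₀ (hσt0 i), one_mul]
    simp only [f, g, Polynomial.derivative_sub, Polynomial.derivative_C, sub_zero,
      Polynomial.derivative_prod_finset, Polynomial.eval_finsetSum,
      Polynomial.eval_prod, Polynomial.derivative_add, Polynomial.derivative_X,
      Polynomial.eval_add, Polynomial.eval_X, Polynomial.eval_C, add_zero,
      zero_add, mul_one]
    simp only [← map_prod]
    rw [← map_sum, Finset.sum_congr rfl this, ← Finset.mul_sum, ht, mul_one]
  have hf'unit : IsUnit (π (f.derivative.eval 0)) := by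
    rw [hf']
    exact ((isUnit_iff_ne_zero.2 (inv_ne_zero hn0)).map (algebraMap K A)).map π
  obtain ⟨y, hy, hyJ⟩ := HenselianRing.is_henselian f hf 0 hf0 hf'unit
  rw [sub_zero] at hyJ
  have hfe : ∀ x, f.eval x = ∏ j ∈ Finset.range r, (x + ψ^[j] (algebraMap K A t⁻¹)) -
      algebraMap K A n⁻¹ * w := fun x => by
    simp [f, g, Polynomial.eval_prod, hψalg']
  have hyfix : ψ y = y := by
    refine eq_of_eval_eq_of_mem_jacobson hjac f (hJ hyJ) hyJ ?_ hf'unit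
    have h0 : ψ (f.eval y) = f.eval (ψ y) := by
      rw [hfe, hfe, map_sub, map_mul, hwfix, hψalg, hσn', map_prod]
      simp only [map_add, ← Function.iterate_succ_apply' ψ]
      rw [prod_range_shift (fun j => ψ y + ψ^[j] (algebraMap K A t⁻¹))]
      rw [hψr]
      rfl
    rw [← h0, hy.eq_zero, map_zero]
  refine ⟨(y + algebraMap K A t⁻¹) * (algebraMap K A t * p₀), ?_⟩
  have hy0 := hfe y
  rw [hy.eq_zero, eq_comm, sub_eq_zero] at hy0
  simp only [iterate_map_mul, iterate_map_add, Function.iterate_fixed hyfix,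
    Finset.prod_mul_distrib, hy0, ← hv]
  simp only [hψalg', ← map_prod]
  change algebraMap K A n⁻¹ * w * (algebraMap K A n * v) = u
  rw [mul_mul_mul_comm, ← map_mul, inv_mul_cancel₀ hn0, map_one, one_mul]
  simp [w]

end

/-- A finite free algebra over a ring complete for a principal ideal is complete. -/
theorem isAdicComplete_of_linearEquiv_pi {R A I : Type} [CommRing R] [CommRing A] [Algebra R A]
    (x : R) [IsAdicComplete (Ideal.span {x}) R] (e : A ≃ₗ[R] (I → R)) :
    IsAdicComplete (Ideal.span {algebraMap R A x}) A := by
  have hR : ∀ (k : ℕ) (y z : R), y ≡ z [SMOD ((Ideal.span {x}) ^ k • ⊤ : Submodule R R)] ↔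
      x ^ k ∣ y - z := fun k y z => by
    rw [SModEq.sub_mem, smul_eq_mul, Ideal.mul_top, Ideal.span_singleton_pow,
      Ideal.mem_span_singleton]
  have hA : ∀ (k : ℕ) (y z : A),
      y ≡ z [SMOD ((Ideal.span {algebraMap R A x}) ^ k • ⊤ : Submodule A A)] ↔
        ∀ i, x ^ k ∣ e y i - e z i := fun k y z => by
    rw [SModEq.sub_mem, smul_eq_mul, Ideal.mul_top, Ideal.span_singleton_pow,
      Ideal.mem_span_singleton]
    constructor
    · rintro ⟨w, hw⟩ i
      rw [← map_pow, ← Algebra.smul_def] at hw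
      exact ⟨e w i, by rw [← Pi.sub_apply, ← map_sub, hw, map_smul]; rfl⟩
    · intro h
      choose w hw using h
      refine ⟨e.symm w, e.injective ?_⟩
      rw [← map_pow, ← Algebra.smul_def, map_smul, e.apply_symm_apply, map_sub]
      exact funext hw
  refine { toIsHausdorff := ⟨fun y hy => e.injective ?_⟩, toIsPrecomplete := ⟨fun f hf => ?_⟩ }
  · ext i
    rw [map_zero]
    refine IsHausdorff.haus' (I := Ideal.span {x}) _ fun k => (hR _ _ _).2 ?_
    simpa using (hA k y 0).1 (hy k) i
  · have : ∀ i, ∃ L : R, ∀ k, e (f k) i ≡ L [SMOD ((Ideal.span {x}) ^ k • ⊤ : Submodule R R)] :=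
      fun i => IsPrecomplete.prec' _ fun {m k} hmk => (hR _ _ _).2 ((hA _ _ _).1 (hf hmk) i)
    choose L hL using this
    refine ⟨e.symm L, fun k => (hA _ _ _).2 fun i => ?_⟩
    rw [e.apply_symm_apply]
    exact (hR _ _ _).1 (hL i k)

theorem iterate_map_map {R : Type} [CommRing R] (f : R →+* R) {r : ℕ} (hf : f^[r] = id) :
    (PowerSeries.map f)^[r] = id := by
  have : ∀ (j : ℕ) (x : PowerSeries R) (i : ℕ),
      PowerSeries.coeff i ((PowerSeries.map f)^[j] x) = f^[j] (PowerSeries.coeff i x) := by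
    intro j x i
    induction j with
    | zero => rfl
    | succ j ih => simp only [Function.iterate_succ_apply', PowerSeries.coeff_map, ih]
  funext x
  ext i
  rw [this, hf]
  rfl

/-- Modulo a `σ`-invariant polynomial with invertible constant term, the indeterminate is a norm. -/
theorem CyclicDualBases.exists_dvd_norm_sub_X {K : Type} [Field K] [Finite K] {σ : K →+* K}
    {r : ℕ} {a b : Fin r → K} (hab : CyclicDualBases σ r a b) (hr : 0 < r)
    (hσr : σ^[r] = id) (χ : Polynomial (PowerSeries K)) (hχ : χ.Monic)
    (hχσ : χ.map (PowerSeries.map σ) = χ) (hχ0 : IsUnit (χ.coeff 0)) :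
    ∃ p, χ ∣ ∏ j ∈ Finset.range r, (Polynomial.mapRingHom (PowerSeries.map σ))^[j] p -
      Polynomial.X := by
  let s : PowerSeries K →+* PowerSeries K := PowerSeries.map σ
  let A := AdjoinRoot χ
  let ψ : A →+* A := AdjoinRoot.map s χ χ (dvd_of_eq hχσ.symm)
  have hof : ∀ t, ψ (AdjoinRoot.of χ t) = AdjoinRoot.of χ (s t) := AdjoinRoot.map_of _ _ _ _
  have hψroot : ψ (AdjoinRoot.root χ) = AdjoinRoot.root χ := AdjoinRoot.map_root _ _ _ _
  have hψmk : Function.Semiconj (AdjoinRoot.mk χ) (Polynomial.mapRingHom s) ψ := by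
    intro p
    induction p using Polynomial.induction_on' with
    | add p q hp hq => simp only [map_add, hp, hq]
    | monomial n t =>
      rw [← Polynomial.C_mul_X_pow_eq_monomial]
      simp [hof, hψroot]
  have hψ : ∀ (t : K) x, ψ (t • x) = σ t • ψ x := by
    intro t x
    rw [Algebra.smul_def, Algebra.smul_def, map_mul]
    congr 1
    change ψ (AdjoinRoot.of χ (PowerSeries.C t)) = AdjoinRoot.of χ (PowerSeries.C (σ t))
    rw [hof]
    simp [s]
  have hψr : ψ^[r] = id := by
    have h1 : (Polynomial.mapRingHom s)^[r] = id := by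
      have : ∀ (j : ℕ) (x : Polynomial (PowerSeries K)) (i : ℕ),
          ((Polynomial.mapRingHom s)^[j] x).coeff i = s^[j] (x.coeff i) := by
        intro j x i
        induction j with
        | zero => rfl
        | succ j ih =>
          simp only [Function.iterate_succ_apply', Polynomial.coe_mapRingHom, Polynomial.coeff_map]
          rw [← Polynomial.coe_mapRingHom, ih]
      funext x
      ext1 i
      rw [this, iterate_map_map σ hσr]
      rfl
    funext x
    obtain ⟨x, rfl⟩ := AdjoinRoot.mk_surjective x
    rw [← (hψmk.iterate_right r).eq, h1]
    rfl
  let e := (AdjoinRoot.powerBasisAux' hχ).equivFun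
  let J : Ideal A := Ideal.span {algebraMap (PowerSeries K) A PowerSeries.X}
  have : IsAdicComplete J A := isAdicComplete_of_linearEquiv_pi _ e
  have : Finite (A ⧸ J) := by
    refine Finite.of_surjective (α := Fin χ.natDegree → K)
      (fun v => Ideal.Quotient.mk J (e.symm fun i => PowerSeries.C (v i))) fun y => ?_
    obtain ⟨y, rfl⟩ := Ideal.Quotient.mk_surjective y
    refine ⟨fun i => PowerSeries.constantCoeff (e y i), (Ideal.Quotient.eq.2 ?_).symm⟩
    have hd : ∀ i, (PowerSeries.X : PowerSeries K) ∣
        e y i - PowerSeries.C (PowerSeries.constantCoeff (e y i)) := fun i => by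
      rw [PowerSeries.X_dvd_iff]
      simp
    choose w hw using hd
    refine Ideal.mem_span_singleton.2 ⟨e.symm w, e.injective ?_⟩
    rw [← Algebra.smul_def, map_smul, map_sub, e.apply_symm_apply, e.apply_symm_apply]
    exact funext hw
  have hJ : J ≤ J.comap ψ := by
    rw [Ideal.span_singleton_le_iff_mem, Ideal.mem_comap]
    have : ψ (algebraMap (PowerSeries K) A PowerSeries.X) =
        algebraMap (PowerSeries K) A PowerSeries.X := by
      change ψ (AdjoinRoot.of χ _) = AdjoinRoot.of χ _
      rw [hof]
      simp [s]
    rw [this]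
    exact Ideal.mem_span_singleton_self _
  have hroot : IsUnit (AdjoinRoot.root χ) := by
    have h1 := congrArg (AdjoinRoot.mk χ) χ.divX_mul_X_add
    rw [AdjoinRoot.mk_self, map_add, map_mul, AdjoinRoot.mk_X, AdjoinRoot.mk_C] at h1
    have h2 := (hχ0.map (AdjoinRoot.of χ)).neg
    rw [← eq_neg_of_add_eq_zero_left h1] at h2
    exact isUnit_of_mul_isUnit_right h2
  obtain ⟨p, hp⟩ := hab.exists_norm_eq hr hσr ψ hψ hψr J hJ hroot.unit hψroot
  obtain ⟨p, rfl⟩ := AdjoinRoot.mk_surjective p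
  refine ⟨p, ?_⟩
  rw [← AdjoinRoot.mk_eq_mk, map_prod, AdjoinRoot.mk_X]
  exact (Finset.prod_congr rfl fun j _ => (hψmk.iterate_right j).eq p).trans hp

/-- The partial norm `δ * τ δ * ⋯ * τ^[j - 1] δ`. -/
def cyclicNorm {G : Type} [Monoid G] (τ : G →* G) (δ : G) (j : ℕ) : G :=
  ((List.range j).map fun i => τ^[i] δ).prod

theorem cyclicNorm_zero {G : Type} [Monoid G] (τ : G →* G) (δ : G) : cyclicNorm τ δ 0 = 1 := rfl

theorem cyclicNorm_succ {G : Type} [Monoid G] (τ : G →* G) (δ : G) (j : ℕ) :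
    cyclicNorm τ δ (j + 1) = cyclicNorm τ δ j * τ^[j] δ := by
  simp [cyclicNorm, List.range_succ]

theorem cyclicNorm_succ' {G : Type} [Monoid G] (τ : G →* G) (δ : G) (j : ℕ) :
    cyclicNorm τ δ (j + 1) = δ * τ (cyclicNorm τ δ j) := by
  induction j with
  | zero => simp [cyclicNorm]
  | succ j ih =>
    rw [cyclicNorm_succ, ih, Function.iterate_succ_apply', mul_assoc, ← map_mul,
      ← cyclicNorm_succ, ih]

theorem cyclicNorm_conj {G : Type} [Group G] (τ : G →* G) (δ g : G) (j : ℕ) :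
    cyclicNorm τ (g⁻¹ * δ * τ g) j = g⁻¹ * cyclicNorm τ δ j * τ^[j] g := by
  induction j with
  | zero => simp [cyclicNorm_zero]
  | succ j ih =>
    rw [cyclicNorm_succ, ih, cyclicNorm_succ, iterate_map_mul, iterate_map_mul, iterate_map_inv,
      ← Function.iterate_succ_apply]
    group

theorem map_cyclicNorm {G : Type} [Group G] (τ : G →* G) (δ : G) (r : ℕ) (hr : τ^[r] = id) :
    δ * τ (cyclicNorm τ δ r) = cyclicNorm τ δ r * δ := by
  rw [← cyclicNorm_succ', cyclicNorm_succ, hr]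
  rfl

/-- The action of a ring endomorphism on invertible matrices of power series, through the
coefficients. -/
abbrev coeffwise {R R' : Type} [CommRing R] [CommRing R'] (f : R →+* R') (n : ℕ) :
    (Matrix (Fin n) (Fin n) (PowerSeries R))ˣ →* (Matrix (Fin n) (Fin n) (PowerSeries R'))ˣ :=
  Units.map (RingHom.mapMatrix (PowerSeries.map f)).toMonoidHom

theorem iterate_mapMatrix_map {R : Type} [CommRing R] (f : R →+* R) {r : ℕ} (hf : f^[r] = id)
    (n : ℕ) : (RingHom.mapMatrix (m := Fin n) (PowerSeries.map f))^[r] = id := by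
  have : ∀ (j : ℕ) (x : Matrix (Fin n) (Fin n) (PowerSeries R)) (i k : Fin n),
      ((RingHom.mapMatrix (m := Fin n) (PowerSeries.map f))^[j] x) i k =
        (PowerSeries.map f)^[j] (x i k) := by
    intro j x i k
    induction j with
    | zero => rfl
    | succ j ih => simp only [Function.iterate_succ_apply', RingHom.mapMatrix_apply,
        Matrix.map_apply, ← ih]
  funext x
  ext1 i k
  rw [this, iterate_map_map f hf]
  rfl

theorem coe_iterate_coeffwise {R : Type} [CommRing R] (f : R →+* R) (n j : ℕ)
    (x : (Matrix (Fin n) (Fin n) (PowerSeries R))ˣ) :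
    (((coeffwise f n)^[j] x : (Matrix (Fin n) (Fin n) (PowerSeries R))ˣ) :
      Matrix (Fin n) (Fin n) (PowerSeries R)) =
        (RingHom.mapMatrix (m := Fin n) (PowerSeries.map f))^[j] x := by
  induction j with
  | zero => rfl
  | succ j ih => rw [Function.iterate_succ_apply', Function.iterate_succ_apply', ← ih]; rfl

theorem iterate_coeffwise {R : Type} [CommRing R] (f : R →+* R) {r : ℕ} (hf : f^[r] = id)
    (n : ℕ) : (coeffwise f n)^[r] = id := by
  funext x
  ext1
  rw [coe_iterate_coeffwise, iterate_mapMatrix_map f hf]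
  rfl

/-- Elements with the same norm `ν` are twisted conjugate by an element of the centralizer of `β`,
if `ν` commutes with this centralizer. -/
theorem CyclicDualBases.exists_eq_inv_mul_mul {K : Type} [Field K] [Finite K] {σ : K →+* K}
    {r : ℕ} {a b : Fin r → K} (hab : CyclicDualBases σ r a b) (hr : 0 < r)
    (hσr : σ^[r] = id) {n : ℕ} (δ δ' β : (Matrix (Fin n) (Fin n) (PowerSeries K))ˣ)
    (hδ : δ * coeffwise σ n β = β * δ) (hδ' : δ' * coeffwise σ n β = β * δ')
    (hN : cyclicNorm (coeffwise σ n) δ' r = cyclicNorm (coeffwise σ n) δ r)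
    (hν : ∀ x : Matrix (Fin n) (Fin n) (PowerSeries K), β * x = x * β →
      cyclicNorm (coeffwise σ n) δ r * x = x * cyclicNorm (coeffwise σ n) δ r) :
    ∃ g, β * g = g * β ∧ δ' = g⁻¹ * δ * coeffwise σ n g := by
  let V := Matrix (Fin n) (Fin n) (PowerSeries K)
  let S : V →+* V := RingHom.mapMatrix (PowerSeries.map σ)
  let Φ : Vˣ → Vˣ → V → V := fun ε ε' x => ε * S x * (ε'⁻¹ : Vˣ)
  have hτS : ∀ ε : Vˣ, S ε = (coeffwise σ n ε : Vˣ) := fun ε => rfl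
  have hΦ : ∀ (ε ε' : Vˣ) (j : ℕ) (x : V), (Φ ε ε')^[j] x =
      cyclicNorm (coeffwise σ n) ε j * S^[j] x * ((cyclicNorm (coeffwise σ n) ε' j)⁻¹ : Vˣ) := by
    intro ε ε' j x
    induction j with
    | zero => simp [cyclicNorm_zero]
    | succ j ih =>
      rw [Function.iterate_succ_apply', ih, cyclicNorm_succ', cyclicNorm_succ',
        Function.iterate_succ_apply']
      simp only [Φ, map_mul, hτS, map_inv, mul_inv_rev, Units.val_mul, mul_assoc]
  have hSr : S^[r] = id := iterate_mapMatrix_map σ hσr n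
  let B : Subalgebra K V := Subalgebra.centralizer K {(β : V)}
  have hB : ∀ x : V, x ∈ B ↔ β * x = x * β := fun x => by
    simp [B, Subalgebra.mem_centralizer_iff]
  have hΦr : ∀ ε' : Vˣ, cyclicNorm (coeffwise σ n) ε' r = cyclicNorm (coeffwise σ n) δ r →
      ∀ x ∈ B, (Φ δ ε')^[r] x = x := by
    intro ε' hε' x hx
    rw [hΦ, hε', hSr, id, hν x ((hB x).1 hx), Units.mul_inv_cancel_right]
  have hδV : (δ : V) * S β = β * δ := congrArg Units.val hδ
  have hΦB : ∀ ε' : Vˣ, ε' * coeffwise σ n β = β * ε' → ∀ x ∈ B, Φ δ ε' x ∈ B := by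
    intro ε' hε' x hx
    rw [hB] at hx ⊢
    have h1 : S β * S x = S x * S β := by rw [← map_mul, hx, map_mul]
    have h2 : S β * (ε'⁻¹ : Vˣ) = (ε'⁻¹ : Vˣ) * β := by
      have := congrArg Units.val (eq_inv_mul_iff_mul_eq.2 hε')
      rw [Units.val_mul, Units.val_mul] at this
      rw [hτS, this]
      simp [mul_assoc]
    simp only [Φ]
    rw [← mul_assoc, ← mul_assoc, ← hδV, mul_assoc (δ : V), h1, mul_assoc, mul_assoc, mul_assoc,
      h2]
    simp only [mul_assoc]
  let ψ₀ : V →+* V :=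
    { toFun := Φ δ δ
      map_one' := by simp [Φ]
      map_zero' := by simp [Φ]
      map_add' := fun x y => by simp [Φ, mul_add, add_mul]
      map_mul' := fun x y => by simp [Φ, mul_assoc] }
  let ψ : B →+* B := (ψ₀.comp B.val.toRingHom).codRestrict B fun x => hΦB δ hδ x x.2
  have hψ : Function.Semiconj Subtype.val ψ (Φ δ δ) := fun x => rfl
  let c : B := ⟨δ * (δ'⁻¹ : Vˣ), by simpa [Φ] using hΦB δ' hδ' 1 (one_mem B)⟩
  have hψc : Function.Semiconj Subtype.val (fun x => ψ x * c) (Φ δ δ') := fun x => by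
    change (δ : V) * S x * (δ⁻¹ : Vˣ) * (δ * (δ'⁻¹ : Vˣ)) = δ * S x * (δ'⁻¹ : Vˣ)
    rw [← mul_assoc, Units.inv_mul_cancel_right]
  let θ : B →+* Matrix (Fin n) (Fin n) K :=
    (RingHom.mapMatrix PowerSeries.constantCoeff).comp B.val.toRingHom
  have : Finite (B ⧸ RingHom.ker θ) := Finite.of_injective _ (RingHom.kerLift_injective θ)
  have hS0 : ∀ x : V, RingHom.mapMatrix PowerSeries.constantCoeff (S x) =
      RingHom.mapMatrix σ (RingHom.mapMatrix PowerSeries.constantCoeff x) := fun x => by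
    ext1 i k
    change PowerSeries.constantCoeff (PowerSeries.map σ (x i k)) =
      σ (PowerSeries.constantCoeff (x i k))
    simp only [← PowerSeries.coeff_zero_eq_constantCoeff_apply, PowerSeries.coeff_map]
  obtain ⟨x, hx, hxu⟩ := hab.exists_fixed_isUnit_mk hr ψ
    (fun t x => by
      have : ∀ y : V, S (t • y) = σ t • S y := fun y => by
        ext i k m
        change σ (t * PowerSeries.coeff m (y i k)) = _
        rw [map_mul]
        rfl
      ext1
      change (δ : V) * S (t • (x : V)) * (δ⁻¹ : Vˣ) = σ t • ((δ : V) * S x * (δ⁻¹ : Vˣ))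
      rw [this, mul_smul_comm, smul_mul_assoc])
    (by
      funext x
      ext1
      rw [(hψ.iterate_right r).eq, hΦr δ rfl x x.2]
      rfl) c
    (by
      funext x
      ext1
      rw [(hψc.iterate_right r).eq, hΦr δ' hN x x.2]
      rfl)
    (RingHom.ker θ)
    (fun x hx => by
      have hx' : RingHom.mapMatrix PowerSeries.constantCoeff (x : V) = 0 := hx
      change RingHom.mapMatrix PowerSeries.constantCoeff ((δ : V) * S x * ((δ⁻¹ : Vˣ) : V)) = 0
      rw [map_mul, map_mul, hS0, hx', map_zero, mul_zero, zero_mul])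
  have hxV : IsUnit (x : V) := by
    have h1 : IsUnit (θ x) := hxu.map (RingHom.kerLift θ)
    rw [Matrix.isUnit_iff_isUnit_det, PowerSeries.isUnit_iff_constantCoeff, RingHom.map_det]
    exact (Matrix.isUnit_iff_isUnit_det _).1 h1
  obtain ⟨g, hg⟩ := hxV
  refine ⟨g, Units.ext ?_, ?_⟩
  · simpa [hg] using (hB x).1 x.2
  · have h1 : Φ δ δ' x = x := (hψc.eq x).symm.trans (congrArg Subtype.val hx)
    rw [← hg] at h1
    have h2 : δ * coeffwise σ n g * δ'⁻¹ = g := Units.ext h1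
    rw [mul_assoc, eq_inv_mul_iff_mul_eq]
    exact (mul_inv_eq_iff_eq_mul.1 h2).symm

theorem mul_map_aeval_eq {R V : Type} [CommRing R] [Ring V] [Algebra R V] (s : R →+* R)
    (S : V →+* V) (hs : ∀ t, S (algebraMap R V t) = algebraMap R V (s t)) {d β : V}
    (h : d * S β = β * d) (f : Polynomial R) :
    d * S (Polynomial.aeval β f) = Polynomial.aeval β (f.map s) * d := by
  induction f using Polynomial.induction_on' with
  | add f g hf hg => simp only [map_add, Polynomial.map_add, mul_add, add_mul, hf, hg]
  | monomial k t =>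
    have h1 : SemiconjBy d (S β) β := h
    rw [Polynomial.map_monomial, Polynomial.aeval_monomial, Polynomial.aeval_monomial, map_mul,
      hs, map_pow, ← mul_assoc, ← Algebra.commutes, mul_assoc, (h1.pow_right k).eq, mul_assoc]

theorem coeffwise_injective {R R' : Type} [CommRing R] [CommRing R'] (f : R →+* R')
    (hf : Function.Injective f) (n : ℕ) : Function.Injective (coeffwise f n) :=
  Units.map_injective (Matrix.map_injective (PowerSeries.map_injective f hf))

theorem exists_coeffwise_eq {κ K : Type} [Field κ] [Finite κ] [Field K] [Finite K] [Algebra κ K]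
    (σ : K →+* K) (hσ : ∀ x, σ x = x ^ Nat.card κ) (n : ℕ)
    (g : (Matrix (Fin n) (Fin n) (PowerSeries K))ˣ) (hg : coeffwise σ n g = g) :
    ∃ k, coeffwise (algebraMap κ K) n k = g := by
  have key : ∀ x : Matrix (Fin n) (Fin n) (PowerSeries K),
      RingHom.mapMatrix (PowerSeries.map σ) x = x →
      ∃ y, RingHom.mapMatrix (PowerSeries.map (algebraMap κ K)) y = x := by
    intro x hx
    have h1 : ∀ i k m, ∃ t, algebraMap κ K t = PowerSeries.coeff m (x i k) := fun i k m =>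
      mem_range_algebraMap_of_frobenius_eq σ hσ _
        (congrArg (PowerSeries.coeff m) (congrFun (congrFun hx i) k))
    choose t ht using h1
    refine ⟨fun i k => PowerSeries.mk (t i k), ?_⟩
    ext i k m
    change algebraMap κ K (PowerSeries.coeff m (PowerSeries.mk (t i k))) = _
    rw [PowerSeries.coeff_mk, ht]
  have hg' : coeffwise σ n g⁻¹ = g⁻¹ := by rw [map_inv, hg]
  obtain ⟨y, hy⟩ := key g (congrArg Units.val hg)
  obtain ⟨y', hy'⟩ := key (g⁻¹ : (Matrix (Fin n) (Fin n) (PowerSeries K))ˣ)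
    (congrArg Units.val hg')
  have hinj : Function.Injective
      (RingHom.mapMatrix (m := Fin n) (PowerSeries.map (algebraMap κ K))) :=
    Matrix.map_injective (PowerSeries.map_injective _ (algebraMap κ K).injective)
  refine ⟨⟨y, y', hinj ?_, hinj ?_⟩, Units.ext hy⟩
  · rw [map_mul, hy, hy', map_one, Units.mul_inv]
  · rw [map_mul, hy, hy', map_one, Units.inv_mul]

/-- Splitting off a factor with prescribed norm. -/
theorem CyclicDualBases.exists_mul_cyclicNorm_eq {K : Type} [Field K] [Finite K] {σ : K →+* K}
    {r : ℕ} {a b : Fin r → K} (hab : CyclicDualBases σ r a b) (hr : 0 < r)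
    (hσr : σ^[r] = id) {n : ℕ} (δ β : (Matrix (Fin n) (Fin n) (PowerSeries K))ˣ)
    (hδ : δ * coeffwise σ n β = β * δ) :
    ∃ z, z * β = β * z ∧
      β * cyclicNorm (coeffwise σ n) (z⁻¹ * δ) r = cyclicNorm (coeffwise σ n) δ r := by
  let V := Matrix (Fin n) (Fin n) (PowerSeries K)
  let S : V →+* V := RingHom.mapMatrix (PowerSeries.map σ)
  let m : Polynomial (PowerSeries K) →+* Polynomial (PowerSeries K) :=
    Polynomial.mapRingHom (PowerSeries.map σ)
  have hδV : (δ : V) * S β = β * δ := congrArg Units.val hδ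
  have hSβ : S β = ((δ⁻¹ : Vˣ) : V) * β * δ := by
    rw [mul_assoc, ← hδV, Units.inv_mul_cancel_left]
  have hχ : (β : V).charpoly.map (PowerSeries.map σ) = (β : V).charpoly := by
    rw [← Matrix.charpoly_map]
    change (S β).charpoly = _
    rw [hSβ, Matrix.coe_units_inv, Matrix.charpoly_units_conj']
  have hχ0 : IsUnit ((β : V).charpoly.coeff 0) := by
    have h1 := (Matrix.isUnit_iff_isUnit_det _).1 β.isUnit
    rw [Matrix.det_eq_sign_charpoly_coeff] at h1
    exact isUnit_of_mul_isUnit_right h1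
  obtain ⟨p, hp⟩ := hab.exists_dvd_norm_sub_X hr hσr _ (Matrix.charpoly_monic _) hχ hχ0
  have hpβ : Polynomial.aeval (β : V) (∏ j ∈ Finset.range r, m^[j] p) = β := by
    obtain ⟨w, hw⟩ := hp
    have h1 := congrArg (Polynomial.aeval (β : V)) hw
    rw [map_mul, Matrix.aeval_self_charpoly, zero_mul, map_sub, Polynomial.aeval_X] at h1
    exact sub_eq_zero.1 h1
  have hcomm : ∀ f : Polynomial (PowerSeries K),
      Commute (Polynomial.aeval (β : V) f) (β : V) := fun f => by
    have := (Commute.all f Polynomial.X).map (Polynomial.aeval (β : V))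
    rwa [Polynomial.aeval_X] at this
  have hz : IsUnit (Polynomial.aeval (β : V) p) := by
    obtain ⟨w, hw⟩ : p ∣ ∏ j ∈ Finset.range r, m^[j] p := by
      have h1 := Finset.dvd_prod_of_mem (fun j => m^[j] p) (Finset.mem_range.2 hr)
      simpa only [Function.iterate_zero, id] using h1
    rw [hw, map_mul] at hpβ
    have h1 : IsUnit (Polynomial.aeval (β : V) p * Polynomial.aeval (β : V) w) :=
      by
      rw [hpβ]
      exact β.isUnit
    exact (((Commute.all p w).map (Polynomial.aeval (β : V))).isUnit_mul_iff.1 h1).1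
  obtain ⟨z, hz⟩ := hz
  have hS : ∀ f : Polynomial (PowerSeries K),
      (δ : V) * S (Polynomial.aeval (β : V) f) = Polynomial.aeval (β : V) (m f) * δ := by
    refine mul_map_aeval_eq (PowerSeries.map σ) S (fun t => ?_) hδV
    ext1 i k
    change PowerSeries.map σ ((algebraMap (PowerSeries K) V t : V) i k) =
      (algebraMap (PowerSeries K) V (PowerSeries.map σ t) : V) i k
    rw [Matrix.algebraMap_matrix_apply, Matrix.algebraMap_matrix_apply]
    split_ifs <;> simp
  have hN : ∀ j, ((cyclicNorm (coeffwise σ n) δ j : Vˣ) : V) =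
      Polynomial.aeval (β : V) (∏ i ∈ Finset.range j, m^[i] p) *
        (cyclicNorm (coeffwise σ n) (z⁻¹ * δ) j : Vˣ) := by
    intro j
    induction j with
    | zero => simp [cyclicNorm_zero]
    | succ j ih =>
      have h1 : ∏ i ∈ Finset.range (j + 1), m^[i] p = m (∏ i ∈ Finset.range j, m^[i] p) * p := by
        rw [Finset.prod_range_succ', map_prod]
        simp only [Function.iterate_succ_apply', Function.iterate_zero, id]
      have h2 : ((coeffwise σ n (cyclicNorm (coeffwise σ n) δ j) : Vˣ) : V) =
          S (cyclicNorm (coeffwise σ n) δ j : Vˣ) := rfl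
      rw [cyclicNorm_succ', Units.val_mul, h2, ih, map_mul, ← mul_assoc, hS, h1, map_mul, ← hz,
        cyclicNorm_succ', Units.val_mul, Units.val_mul]
      simp only [mul_assoc, Units.mul_inv_cancel_left]
      rfl
  refine ⟨z, Units.ext (by rw [Units.val_mul, Units.val_mul, hz]; exact hcomm p), Units.ext ?_⟩
  rw [hN r, hpβ]
  rfl

/-- The norm map bijection on conjugacy classes.  `F` is a local field of characteristic `p`
with ring of integers `O = κ⟦ϖ⟧` (κ the residue field, of cardinality `q`), `F_r/F` the
unramified extension of degree `r` with ring of integers `O_r = κ_r⟦ϖ⟧` and `σ` the lift of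
`q`-Frobenius (acting on coefficients).  The norm map `N(δ) = δ·σ(δ)⋯σ^{r−1}(δ)` induces a
bijection from `GL_n(O_r)`-`σ`-conjugacy classes in `GL_n(O_r)` to `GL_n(O)`-conjugacy classes
in `GL_n(O)`: (1) for every `δ ∈ GL_n(O_r)` the conjugacy class of `N(δ)` meets `GL_n(O)` in a
well-defined `GL_n(O)`-conjugacy class, (2) two elements are `σ`-conjugate iff the resulting
elements of `GL_n(O)` are conjugate, and (3) every `GL_n(O)`-conjugacy class arises this way. -/
theorem norm_map_bijection_on_conjugacy_classes
    (q r n : ℕ) (hr : 0 < r)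
    (κ K : Type) [Field κ] [Fintype κ] (hq : Fintype.card κ = q)
    [Field K] [Fintype K] [Algebra κ K] (hrdeg : Module.finrank κ K = r)
    (σ : K ≃+* K) (hσ : ∀ x : K, σ x = x ^ q)
    (ι : (Matrix (Fin n) (Fin n) (PowerSeries κ))ˣ →* (Matrix (Fin n) (Fin n) (PowerSeries K))ˣ)
    (hι : ι = Units.map ((RingHom.mapMatrix (PowerSeries.map (algebraMap κ K))).toMonoidHom))
    (σG : (Matrix (Fin n) (Fin n) (PowerSeries K))ˣ →* (Matrix (Fin n) (Fin n) (PowerSeries K))ˣ)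
    (hσG : σG = Units.map ((RingHom.mapMatrix (PowerSeries.map (σ : K →+* K))).toMonoidHom))
    (Nm : (Matrix (Fin n) (Fin n) (PowerSeries K))ˣ → (Matrix (Fin n) (Fin n) (PowerSeries K))ˣ)
    (hNm : ∀ δ, Nm δ = ((List.range r).map fun i => (⇑σG)^[i] δ).prod) :
    (∀ δ : (Matrix (Fin n) (Fin n) (PowerSeries K))ˣ,
      ∃ γ : (Matrix (Fin n) (Fin n) (PowerSeries κ))ˣ, IsConj (ι γ) (Nm δ)) ∧
    (∀ (δ δ' : (Matrix (Fin n) (Fin n) (PowerSeries K))ˣ)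
       (γ γ' : (Matrix (Fin n) (Fin n) (PowerSeries κ))ˣ),
      IsConj (ι γ) (Nm δ) → IsConj (ι γ') (Nm δ') →
      ((∃ g : (Matrix (Fin n) (Fin n) (PowerSeries K))ˣ, δ' = g⁻¹ * δ * σG g) ↔ IsConj γ γ')) ∧
    (∀ γ : (Matrix (Fin n) (Fin n) (PowerSeries κ))ˣ,
      ∃ δ : (Matrix (Fin n) (Fin n) (PowerSeries K))ˣ, IsConj (ι γ) (Nm δ)) := by
  subst hι hσG
  obtain rfl : Nm = fun δ => cyclicNorm (coeffwise (σ : K →+* K) n) δ r := funext hNm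
  have hσ' : ∀ x, (σ : K →+* K) x = x ^ Nat.card κ := fun x => by
    rw [Nat.card_eq_fintype_card, hq]
    exact hσ x
  have hσr : (σ : K →+* K)^[r] = id := by
    funext x
    rw [← hrdeg]
    exact frobenius_iterate_finrank _ hσ' x
  obtain ⟨a, b, hab⟩ := exists_cyclicDualBases hrdeg (σ : K →+* K) hσ'
  change (∀ δ, ∃ γ, IsConj (coeffwise (algebraMap κ K) n γ)
      (cyclicNorm (coeffwise (σ : K →+* K) n) δ r)) ∧
    (∀ δ δ' γ γ', IsConj (coeffwise (algebraMap κ K) n γ)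
        (cyclicNorm (coeffwise (σ : K →+* K) n) δ r) →
      IsConj (coeffwise (algebraMap κ K) n γ') (cyclicNorm (coeffwise (σ : K →+* K) n) δ' r) →
      ((∃ g, δ' = g⁻¹ * δ * coeffwise (σ : K →+* K) n g) ↔ IsConj γ γ')) ∧
    (∀ γ, ∃ δ, IsConj (coeffwise (algebraMap κ K) n γ)
      (cyclicNorm (coeffwise (σ : K →+* K) n) δ r))
  set τ := coeffwise (σ : K →+* K) n with hτ
  set ι := coeffwise (algebraMap κ K) n
  have hτr : τ^[r] = id := iterate_coeffwise _ hσr n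
  have hfix : ∀ g, τ g = g → ∃ k, ι k = g := exists_coeffwise_eq _ hσ' n
  have hτι : ∀ k, τ (ι k) = ι k := fun k => by
    ext i j m
    change σ (algebraMap κ K (PowerSeries.coeff m ((k : Matrix _ _ _) i j))) = algebraMap κ K _
    rw [hσ, ← hq, ← map_pow, FiniteField.pow_card]
    rfl
  have hN1 : cyclicNorm τ 1 r = 1 := by simp [cyclicNorm, iterate_map_one]
  have hconj : ∀ δ g, cyclicNorm τ (g⁻¹ * δ * τ g) r = g⁻¹ * cyclicNorm τ δ r * g := fun δ g => by
    rw [cyclicNorm_conj, hτr, id]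
  refine ⟨fun δ => ?_, fun δ δ' γ γ' h h' => ⟨?_, fun hγ => ?_⟩, fun γ => ?_⟩
  · set β := cyclicNorm τ δ r
    have hδ : δ * τ β = β * δ := map_cyclicNorm τ δ r hτr
    obtain ⟨z, hz, hzN⟩ := hab.exists_mul_cyclicNorm_eq hr hσr δ β hδ
    obtain ⟨g, -, hg⟩ := hab.exists_eq_inv_mul_mul hr hσr 1 (z⁻¹ * δ) 1 (by simp) (by simp)
      (by rw [hN1]; exact mul_eq_left.1 hzN) (fun x _ => by rw [hN1]; simp)
    rw [← hτ] at hg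
    obtain ⟨γ, hγ⟩ := hfix (g * β * g⁻¹) (by
      have h1 : τ g = g * (z⁻¹ * δ) := by rw [hg]; group
      rw [map_mul, map_mul, map_inv, h1, mul_inv_eq_iff_eq_mul]
      calc g * (z⁻¹ * δ) * τ β = g * z⁻¹ * (δ * τ β) := by group
        _ = g * z⁻¹ * (β * z) * z⁻¹ * δ := by rw [hδ]; group
        _ = g * β * g⁻¹ * (g * (z⁻¹ * δ)) := by rw [← hz]; group)
    refine ⟨γ, IsConj.symm ?_⟩
    rw [hγ]
    exact isConj_iff.2 ⟨g, rfl⟩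
  · rintro ⟨g, rfl⟩
    rw [hconj] at h'
    have h1 : IsConj (ι γ) (ι γ') :=
      (h.trans (isConj_iff.2 ⟨g⁻¹, by rw [inv_inv]⟩)).trans h'.symm
    obtain ⟨w, hw⟩ := isConj_iff.1 h1
    have hcw : w⁻¹ * 1 * τ w * ι γ = ι γ * (w⁻¹ * 1 * τ w) := by
      have h2 := congrArg τ hw
      rw [map_mul, map_mul, map_inv, hτι, hτι, mul_inv_eq_iff_eq_mul] at h2
      rw [mul_assoc, h2, ← hw]
      group
    obtain ⟨g', hg'γ, hg'⟩ := hab.exists_eq_inv_mul_mul hr hσr 1 (w⁻¹ * 1 * τ w) (ι γ)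
      (by rw [← hτ, hτι, one_mul, mul_one]) (by rw [← hτ, hτι, hcw])
      (by rw [← hτ, hconj, hN1]; group) (fun x _ => by rw [← hτ, hN1]; simp)
    rw [← hτ] at hg'
    obtain ⟨k, hk⟩ := hfix (w * g'⁻¹) (by
      have h2 : τ w * (τ g')⁻¹ = w * (w⁻¹ * 1 * τ w) * (τ g')⁻¹ := by group
      rw [map_mul, map_inv, h2, hg']
      group)
    refine isConj_iff.2 ⟨k, coeffwise_injective _ (algebraMap κ K).injective n ?_⟩
    change ι (k * γ * k⁻¹) = ι γ'
    have h3 : g'⁻¹ * ι γ * g' = ι γ := by rw [mul_assoc, hg'γ, inv_mul_cancel_left]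
    have h4 : w * g'⁻¹ * ι γ * (w * g'⁻¹)⁻¹ = w * (g'⁻¹ * ι γ * g') * w⁻¹ := by group
    rw [map_mul, map_mul, map_inv, hk, h4, h3, hw]
  · have h1 : IsConj (cyclicNorm τ δ r) (cyclicNorm τ δ' r) :=
      (h.symm.trans (ι.map_isConj hγ)).trans h'
    obtain ⟨w, hw⟩ := isConj_iff.1 h1
    have hNw : cyclicNorm τ (w⁻¹ * δ' * τ w) r = cyclicNorm τ δ r := by
      rw [hconj, ← hw]
      group
    obtain ⟨g, -, hg⟩ := hab.exists_eq_inv_mul_mul hr hσr δ (w⁻¹ * δ' * τ w) (cyclicNorm τ δ r)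
      (map_cyclicNorm τ δ r hτr) (hNw ▸ map_cyclicNorm τ (w⁻¹ * δ' * τ w) r hτr) hNw
      (fun _ hx => hx)
    rw [← hτ, mul_assoc, inv_mul_eq_iff_eq_mul, ← eq_mul_inv_iff_mul_eq] at hg
    refine ⟨g * w⁻¹, ?_⟩
    rw [hg, map_mul, map_inv]
    group
  · obtain ⟨z, -, hz⟩ := hab.exists_mul_cyclicNorm_eq hr hσr 1 (ι γ)⁻¹
      (by rw [← hτ, map_inv, hτι, one_mul, mul_one])
    refine ⟨z⁻¹ * 1, ?_⟩
    rw [← hτ, hN1, inv_mul_eq_one] at hz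
    rw [hz]
end
end
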